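/- Let K be a linear operator expressed in the self-conjugate basis, K = Σ_{nn'} K_{nn'}|e_n⟩⟨e_{n'}|. The efficient map ρ ↦ KρK† satisfies K θ̂|ψ⟩⟨ψ|θ̂† K† = θ̂ K|ψ⟩⟨ψ|K† θ̂† for all vectors |ψ⟩ if and only if there exists a phase e^{iφ} such that all entries of e^{iφ}K are real. -/

import Mathlib

open Complex Matrix

/-- The rank-one "projector" matrix `|u⟩⟨u|` of a vector `u`. -/
noncomputable def outer {ι : Type*} (u : ι → ℂ) : Matrix ι ι ℂ :=
  Matrix.vecMulVec u (fun i => (starRingEnd ℂ) (u i))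

/-- Entrywise form of the time-reversal invariance condition. -/
theorem outer_mulVec_conj_eq_iff {d : ℕ} (K : Matrix (Fin d) (Fin d) ℂ) (ψ : Fin d → ℂ) :
    outer (K.mulVec (fun i => (starRingEnd ℂ) (ψ i)))
        = (outer (K.mulVec ψ)).map (starRingEnd ℂ)
      ↔ ∀ i j, K.mulVec (fun i => (starRingEnd ℂ) (ψ i)) i
          * (starRingEnd ℂ) (K.mulVec (fun i => (starRingEnd ℂ) (ψ i)) j)
        = (starRingEnd ℂ) (K.mulVec ψ i) * K.mulVec ψ j := by
  simp [← Matrix.ext_iff, outer, vecMulVec_apply]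

/-- Polarization: time-reversal invariance on pure states forces all products
`K i k * conj (K j l)` to be real. -/
theorem entry_mul_conj_entry_real {d : ℕ} (K : Matrix (Fin d) (Fin d) ℂ)
    (h : ∀ ψ : Fin d → ℂ,
        outer (K.mulVec (fun i => (starRingEnd ℂ) (ψ i)))
          = (outer (K.mulVec ψ)).map (starRingEnd ℂ)) (i j k l : Fin d) :
    K i k * (starRingEnd ℂ) (K j l) = (starRingEnd ℂ) (K i k) * K j l := by
  have key : ∀ a b : ℂ,
      (a * K i k + b * K i l) * (starRingEnd ℂ) (a * K j k + b * K j l)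
        = (a * (starRingEnd ℂ) (K i k) + b * (starRingEnd ℂ) (K i l))
          * ((starRingEnd ℂ) a * K j k + (starRingEnd ℂ) b * K j l) := by
    intro a b
    have hconj : (fun m => (starRingEnd ℂ)
        (((starRingEnd ℂ) a • Pi.single k 1 + (starRingEnd ℂ) b • Pi.single l 1 :
          Fin d → ℂ) m)) = (a • Pi.single k 1 + b • Pi.single l 1 : Fin d → ℂ) := by
      ext m
      simp [Pi.single_apply, apply_ite (starRingEnd ℂ)]
    have := (outer_mulVec_conj_eq_iff K _).1
      (h ((starRingEnd ℂ) a • Pi.single k 1 + (starRingEnd ℂ) b • Pi.single l 1)) i j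
    rw [hconj] at this
    simpa [mulVec_add, mulVec_smul] using this
  have hk := key 1 0
  have hl := key 0 1
  have hadd := key 1 1
  have hI := key 1 I
  simp only [map_add, map_mul, map_one, map_zero, conj_I] at hk hl hadd hI
  linear_combination (1 / 2) * (hadd - hk - hl) + (I / 2) * (hI - hk - hl)
    + (1 / 2) * (K i k * (starRingEnd ℂ) (K j l) - (starRingEnd ℂ) (K i k) * K j l) * I_sq
    + (I / 2) * ((starRingEnd ℂ) (K j l) * K i l - (starRingEnd ℂ) (K i l) * K j l) * I_sq
    + (1 / 2) * ((starRingEnd ℂ) (K i l) * K j k - K i l * (starRingEnd ℂ) (K j k)) * I_sq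

/-- in the self-conjugate basis (where `θ̂` acts by componentwise complex
conjugation), the efficient map `ρ ↦ KρK†` commutes with conjugation by `θ̂` on all
pure states, i.e. `K θ̂|ψ⟩⟨ψ|θ̂† K† = θ̂ K|ψ⟩⟨ψ|K† θ̂†` for all `ψ`, iff there is a
phase `e^{iφ}` such that all entries of `e^{iφ} K` are real. -/
theorem efficient_map_is_TRIO_iff_real
    {d : ℕ} (K : Matrix (Fin d) (Fin d) ℂ) :
    (∀ ψ : Fin d → ℂ,
        outer (K.mulVec (fun i => (starRingEnd ℂ) (ψ i)))
          = (outer (K.mulVec ψ)).map (starRingEnd ℂ))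
      ↔ ∃ φ : ℝ, ∀ i j, (Complex.exp (Complex.I * (φ : ℂ)) * K i j).im = 0 := by
  constructor
  · intro h
    by_cases hK : ∃ i j, K i j ≠ 0
    · obtain ⟨a, b, hab⟩ := hK
      refine ⟨-(K a b).arg, fun i j => ?_⟩
      have hreal : (K i j * (starRingEnd ℂ) (K a b)).im = 0 := by
        rw [← conj_eq_iff_im]
        simpa using (entry_mul_conj_entry_real K h i a j b).symm
      have hnorm : ((‖K a b‖ : ℝ) : ℂ) ≠ 0 := by simpa using hab
      have hphase : exp (I * ((-(K a b).arg : ℝ) : ℂ)) * (‖K a b‖ : ℂ)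
          = (starRingEnd ℂ) (K a b) := by
        conv_rhs => rw [← norm_mul_exp_arg_mul_I (K a b)]
        rw [map_mul, conj_ofReal, ← exp_conj, map_mul, conj_ofReal, conj_I, mul_comm]
        push_cast
        ring_nf
      have hentry : exp (I * ((-(K a b).arg : ℝ) : ℂ)) * K i j
          = K i j * (starRingEnd ℂ) (K a b) / (‖K a b‖ : ℂ) := by
        rw [eq_div_iff hnorm, ← hphase]
        ring
      rw [hentry, div_ofReal_im, hreal, zero_div]
    · push Not at hK
      exact ⟨0, fun i j => by simp [hK i j]⟩
  · rintro ⟨φ, hφ⟩ ψ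
    set u := exp (I * (φ : ℂ)) with hu
    have hunit : (starRingEnd ℂ) u * u = 1 := by
      rw [hu, ← exp_conj, ← exp_add]
      simp
    have hconj : ∀ i j, (starRingEnd ℂ) (K i j) = u ^ 2 * K i j := by
      intro i j
      have := conj_eq_iff_im.2 (hφ i j)
      rw [map_mul] at this
      linear_combination u * this - (starRingEnd ℂ) (K i j) * hunit
    have hvec : ∀ i, (starRingEnd ℂ) (K.mulVec ψ i)
        = u ^ 2 * K.mulVec (fun i => (starRingEnd ℂ) (ψ i)) i := by
      intro i
      simp only [mulVec, dotProduct, map_sum, map_mul, hconj, Finset.mul_sum, mul_assoc]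
    rw [outer_mulVec_conj_eq_iff]
    intro i j
    have hj := congrArg (starRingEnd ℂ) (hvec j)
    rw [conj_conj, map_mul, map_pow] at hj
    rw [hvec i, hj]
    linear_combination (-((starRingEnd ℂ) u * u + 1)
      * (K.mulVec (fun i => (starRingEnd ℂ) (ψ i)) i
      * (starRingEnd ℂ) (K.mulVec (fun i => (starRingEnd ℂ) (ψ i)) j))) * hunit
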